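/- arXiv:1901.05128 — 4 statements merged into one kernel-verified Lean document; each statement's English description precedes it below -/
import Mathlib

section
/- Let α ∈ (0,1) and let z ∈ ℂ with Re z > 0. Then z^α = (1/(Γ(1-α)Γ(α))) ∫₀^∞ s^{α-1} · z/(s+z) ds, where z^α = exp(α Log z) is the principal power. -/
open MeasureTheory

lemma aux_int {β b : ℝ} (hβ : -1 < β) (hb : 0 < b) :
    IntegrableOn (fun t : ℝ => t ^ β * Real.exp (-(b * t))) (Set.Ioi 0) := by
  have := integrableOn_rpow_mul_exp_neg_mul_rpow hβ one_pos hb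
  simpa using this

lemma aux_norm {t β : ℝ} (ht : 0 < t) (z : ℂ) :
    ‖((t ^ β : ℝ) : ℂ) * Complex.exp (-(z * t))‖ = t ^ β * Real.exp (-(z.re * t)) := by
  rw [norm_mul, Complex.norm_exp, Complex.norm_real, Real.norm_of_nonneg (by positivity)]
  simp

lemma aux_meas (β : ℝ) (z : ℂ) :
    AEStronglyMeasurable (fun t : ℝ => ((t ^ β : ℝ) : ℂ) * Complex.exp (-(z * t)))
      (volume.restrict (Set.Ioi 0)) := by
  apply Measurable.aestronglyMeasurable
  fun_prop

lemma aux_cint {β : ℝ} {z : ℂ} (hβ : -1 < β) (hz : 0 < z.re) :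
    IntegrableOn (fun t : ℝ => ((t ^ β : ℝ) : ℂ) * Complex.exp (-(z * t))) (Set.Ioi 0) := by
  refine (aux_int hβ hz).mono' (aux_meas β z) ?_
  filter_upwards [ae_restrict_mem measurableSet_Ioi] with t ht
  exact (aux_norm ht z).le

lemma aux_diff {β : ℝ} {z : ℂ} (hβ : -1 < β) (hz : 0 < z.re) :
    DifferentiableAt ℂ (fun w : ℂ => ∫ t in Set.Ioi (0 : ℝ),
      ((t ^ β : ℝ) : ℂ) * Complex.exp (-(w * t))) z := by
  have hs : {w : ℂ | z.re / 2 < w.re} ∈ nhds z :=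
    (isOpen_lt continuous_const Complex.continuous_re).mem_nhds (by simp; linarith)
  have := hasDerivAt_integral_of_dominated_loc_of_deriv_le
    (μ := volume.restrict (Set.Ioi (0 : ℝ)))
    (F := fun (w : ℂ) (t : ℝ) => ((t ^ β : ℝ) : ℂ) * Complex.exp (-(w * t)))
    (F' := fun (w : ℂ) (t : ℝ) => ((t ^ β : ℝ) : ℂ) * (Complex.exp (-(w * t)) * (-t)))
    (bound := fun t => t ^ (β + 1) * Real.exp (-(z.re / 2 * t)))
    hs (Filter.Eventually.of_forall fun w => aux_meas β w) (aux_cint hβ hz)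
    (by apply Measurable.aestronglyMeasurable; fun_prop) ?_
    (aux_int (by linarith) (by linarith)) ?_
  · exact this.2.differentiableAt
  · filter_upwards [ae_restrict_mem measurableSet_Ioi] with t ht w hw
    have ht' : (0 : ℝ) < t := ht
    rw [← mul_assoc, norm_mul, aux_norm ht w, norm_neg, Complex.norm_real,
      Real.norm_of_nonneg ht'.le, Real.rpow_add_one ht'.ne', mul_right_comm]
    have : z.re / 2 < w.re := hw
    gcongr
  · refine Filter.Eventually.of_forall fun t w _ => ?_
    have h1 : HasDerivAt (fun w : ℂ => -(w * t)) (-(t : ℂ)) w := by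
      simpa using! ((hasDerivAt_id w).mul_const (t : ℂ)).neg
    exact (h1.cexp).const_mul _

lemma aux_gamma {a : ℝ} {z : ℂ} (ha : 0 < a) (hz : 0 < z.re) :
    ∫ t in Set.Ioi (0 : ℝ), ((t ^ (a - 1) : ℝ) : ℂ) * Complex.exp (-(z * t)) =
      z ^ (-(a : ℂ)) * Real.Gamma a := by
  have hopen : IsOpen {w : ℂ | 0 < w.re} := isOpen_lt continuous_const Complex.continuous_re
  have hf : AnalyticOnNhd ℂ (fun w : ℂ => ∫ t in Set.Ioi (0 : ℝ),
      ((t ^ (a - 1) : ℝ) : ℂ) * Complex.exp (-(w * t))) {w : ℂ | 0 < w.re} :=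
    DifferentiableOn.analyticOnNhd
      (fun w hw => (aux_diff (by linarith) hw).differentiableWithinAt) hopen
  have hg : AnalyticOnNhd ℂ (fun w : ℂ => w ^ (-(a : ℂ)) * Real.Gamma a) {w : ℂ | 0 < w.re} :=
    DifferentiableOn.analyticOnNhd
      (fun w hw => ((differentiableAt_id.cpow_const (Or.inl hw)).mul_const
        _).differentiableWithinAt) hopen
  have hreal : ∀ r : ℝ, 0 < r →
      ∫ t in Set.Ioi (0 : ℝ), ((t ^ (a - 1) : ℝ) : ℂ) * Complex.exp (-(r * t)) =
      (r : ℂ) ^ (-(a : ℂ)) * Real.Gamma a := by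
    intro r hr
    have h := Real.integral_rpow_mul_exp_neg_mul_Ioi ha hr
    have h2 := congrArg (fun x : ℝ => (x : ℂ)) h
    simp only [← integral_complex_ofReal] at h2
    push_cast at h2 ⊢
    rw [h2, one_div, Real.inv_rpow hr.le, ← Real.rpow_neg hr.le, Complex.ofReal_cpow hr.le]
    push_cast
    rfl
  refine hf.eqOn_of_preconnected_of_frequently_eq hg
    (convex_halfSpace_re_gt 0).isPreconnected (z₀ := 1) (by simp) ?_ hz
  have ht : Filter.Tendsto (fun x : ℝ => (x : ℂ)) (nhdsWithin 1 {1}ᶜ) (nhdsWithin 1 {1}ᶜ) := by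
    refine tendsto_nhdsWithin_iff.2 ⟨?_, ?_⟩
    · exact (Complex.continuous_ofReal.tendsto' 1 1 (by simp)).mono_left nhdsWithin_le_nhds
    · filter_upwards [self_mem_nhdsWithin] with x hx
      simpa using hx
  refine ht.frequently (Filter.Eventually.frequently ?_)
  filter_upwards [nhdsWithin_le_nhds (Ioi_mem_nhds (zero_lt_one (α := ℝ)))] with r hr
  exact hreal r hr

lemma aux_fubini {α : ℝ} (hα : α ∈ Set.Ioo (0 : ℝ) 1) {z : ℂ} (hz : 0 < z.re) :
    Integrable (Function.uncurry fun (s t : ℝ) =>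
      ((s ^ (α - 1) : ℝ) : ℂ) * Complex.exp (-((s + z) * t)))
      ((volume.restrict (Set.Ioi 0)).prod (volume.restrict (Set.Ioi 0))) := by
  have hm : AEStronglyMeasurable (Function.uncurry fun (s t : ℝ) =>
      ((s ^ (α - 1) : ℝ) : ℂ) * Complex.exp (-((s + z) * t)))
      ((volume.restrict (Set.Ioi 0)).prod (volume.restrict (Set.Ioi 0))) := by
    apply Measurable.aestronglyMeasurable
    unfold Function.uncurry
    fun_prop
  have hsplit : ∀ s t : ℝ, ((s ^ (α - 1) : ℝ) : ℂ) * Complex.exp (-((s + z) * t)) =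
      Complex.exp (-(z * t)) * (((s ^ (α - 1) : ℝ) : ℂ) * Complex.exp (-(t * s))) := by
    intro s t
    rw [mul_left_comm, ← Complex.exp_add]
    ring_nf
  refine (integrable_prod_iff' hm).2 ⟨?_, ?_⟩
  · filter_upwards [ae_restrict_mem measurableSet_Ioi] with t ht
    simp only [Function.uncurry, hsplit]
    exact (aux_cint (by linarith [hα.1]) (by simpa using ht)).const_mul _
  · refine (((aux_int (β := (1 - α) - 1) (by linarith [hα.2]) hz).mul_const
      (Real.Gamma α))).congr ?_
    filter_upwards [ae_restrict_mem measurableSet_Ioi] with t ht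
    have ht' : (0 : ℝ) < t := ht
    simp only [Function.uncurry, hsplit]
    have : ∫ s in Set.Ioi (0 : ℝ), ‖Complex.exp (-(z * t)) *
        (((s ^ (α - 1) : ℝ) : ℂ) * Complex.exp (-(t * s)))‖ =
        ∫ s in Set.Ioi (0 : ℝ), Real.exp (-(z.re * t)) *
          (s ^ (α - 1) * Real.exp (-(t * s))) := by
      refine setIntegral_congr_fun measurableSet_Ioi fun s hs => ?_
      rw [norm_mul, aux_norm hs, Complex.norm_exp]
      simp
    rw [this, integral_const_mul, Real.integral_rpow_mul_exp_neg_mul_Ioi hα.1 ht', one_div,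
      Real.inv_rpow ht'.le, ← Real.rpow_neg ht'.le]
    ring_nf

/-- For `α ∈ (0,1)` and `z ∈ ℂ` with `Re z > 0`,
`z^α = (1/(Γ(1-α)Γ(α))) ∫₀^∞ s^{α-1} · z/(s+z) ds`, where `z^α` is the principal power. -/
theorem statement1 (α : ℝ) (hα : α ∈ Set.Ioo (0 : ℝ) 1) (z : ℂ) (hz : 0 < z.re) :
    z ^ (α : ℂ) =
      ((1 / (Real.Gamma (1 - α) * Real.Gamma α) : ℝ) : ℂ) *
        ∫ s in Set.Ioi (0 : ℝ), (s : ℂ) ^ ((α : ℂ) - 1) * (z / (s + z)) := by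
  have hz0 : z ≠ 0 := by rintro rfl; simp at hz
  have h1 : ∫ s in Set.Ioi (0 : ℝ), (s : ℂ) ^ ((α : ℂ) - 1) * (z / (s + z)) =
      z * ∫ s in Set.Ioi (0 : ℝ), ∫ t in Set.Ioi (0 : ℝ),
        ((s ^ (α - 1) : ℝ) : ℂ) * Complex.exp (-((s + z) * t)) := by
    rw [← integral_const_mul]
    refine setIntegral_congr_fun measurableSet_Ioi fun s hs => ?_
    have hs' : (0 : ℝ) < s := hs
    have h := integral_exp_mul_complex_Ioi (a := -(s + z)) (by simp; linarith) 0
    simp only [neg_mul] at h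
    rw [integral_const_mul, h, Complex.ofReal_cpow hs'.le]
    push_cast
    simp only [mul_zero, neg_zero, Complex.exp_zero, neg_div_neg_eq]
    ring
  have h2 : ∫ t in Set.Ioi (0 : ℝ), ∫ s in Set.Ioi (0 : ℝ),
        ((s ^ (α - 1) : ℝ) : ℂ) * Complex.exp (-((s + z) * t)) =
      ∫ t in Set.Ioi (0 : ℝ), (Real.Gamma α : ℂ) *
        (((t ^ ((1 - α) - 1) : ℝ) : ℂ) * Complex.exp (-(z * t))) := by
    refine setIntegral_congr_fun measurableSet_Ioi fun t ht => ?_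
    have ht' : (0 : ℝ) < t := ht
    have hsplit : ∀ s : ℝ, ((s ^ (α - 1) : ℝ) : ℂ) * Complex.exp (-((s + z) * t)) =
        Complex.exp (-(z * t)) * (((s ^ (α - 1) : ℝ) : ℂ) * Complex.exp (-(t * s))) := by
      intro s
      rw [mul_left_comm, ← Complex.exp_add]
      ring_nf
    simp only [hsplit]
    rw [integral_const_mul, aux_gamma hα.1 (by simpa using ht'),
      show (1 - α) - 1 = -α by ring, Complex.ofReal_cpow ht'.le]
    push_cast
    ring
  rw [h1, integral_integral_swap (aux_fubini hα hz), h2, integral_const_mul,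
    aux_gamma (by linarith [hα.2]) hz]
  have g1 : (Real.Gamma α : ℂ) ≠ 0 := by
    exact_mod_cast (Real.Gamma_pos_of_pos hα.1).ne'
  have g2 : (Real.Gamma (1 - α) : ℂ) ≠ 0 := by
    exact_mod_cast (Real.Gamma_pos_of_pos (by linarith [hα.2] : 0 < 1 - α)).ne'
  have h3 : z ^ (-((1 - α : ℝ) : ℂ)) = z ^ (α : ℂ) / z := by
    rw [show (-((1 - α : ℝ) : ℂ)) = (α : ℂ) - 1 by push_cast; ring, Complex.cpow_sub _ _ hz0,
      Complex.cpow_one]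
  rw [h3]
  push_cast
  field_simp
end

section
/- Let α ∈ (0,1), τ > 0, and let i ≥ 2 be an integer. Then ∫₀^∞ s^{α-1} · (τ s)/(τ s + 1)^{i+1} ds = (τ^{-α}/4) ∫_{-1}^{1} (1-s)^α (1+s)^{1-α} ((1+s)/2)^{i-2} ds. -/
open MeasureTheory

/-- For `α ∈ (0,1)`, `τ > 0` and integer `i ≥ 2`,
`∫₀^∞ s^{α-1} (τ s)/(τ s + 1)^{i+1} ds
  = (τ^{-α}/4) ∫_{-1}^{1} (1-s)^α (1+s)^{1-α} ((1+s)/2)^{i-2} ds`. -/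
theorem statement3 (α τ : ℝ) (hα : α ∈ Set.Ioo (0 : ℝ) 1) (hτ : 0 < τ)
    (i : ℕ) (hi : 2 ≤ i) :
    ∫ s in Set.Ioi (0 : ℝ), s ^ (α - 1) * (τ * s / (τ * s + 1) ^ (i + 1)) =
      τ ^ (-α) / 4 *
        ∫ s in Set.Ioo (-1 : ℝ) 1,
          (1 - s) ^ α * (1 + s) ^ (1 - α) * ((1 + s) / 2) ^ (i - 2) := by
  have himg : (fun x : ℝ => 2 / (τ * x + 1) - 1) '' Set.Ioi 0 = Set.Ioo (-1 : ℝ) 1 := by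
    ext y
    simp only [Set.mem_image, Set.mem_Ioi, Set.mem_Ioo]
    constructor
    · rintro ⟨x, hx, rfl⟩
      have hu : 0 < τ * x := mul_pos hτ hx
      have h1 : 0 < 2 / (τ * x + 1) := by positivity
      have h2 : 2 / (τ * x + 1) < 2 := by
        rw [div_lt_iff₀ (by positivity)]; linarith
      constructor <;> linarith
    · rintro ⟨h1, h2⟩
      have h3 : 0 < 1 + y := by linarith
      have h4 : 0 < 1 - y := by linarith
      refine ⟨(1 - y) / (1 + y) / τ, by positivity, ?_⟩
      have : τ * ((1 - y) / (1 + y) / τ) + 1 = 2 / (1 + y) := by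
        field_simp; ring
      rw [this]; field_simp; ring
  have hinj : Set.InjOn (fun x : ℝ => 2 / (τ * x + 1) - 1) (Set.Ioi 0) := by
    intro x hx y hy h
    have hx' : 0 < τ * x := mul_pos hτ hx
    have hy' : 0 < τ * y := mul_pos hτ hy
    have h' : 2 / (τ * x + 1) = 2 / (τ * y + 1) := by
      simpa using h
    rw [div_eq_div_iff (by positivity) (by positivity)] at h'
    have : τ * x = τ * y := by linarith
    exact mul_left_cancel₀ hτ.ne' this
  have hder : ∀ x ∈ Set.Ioi (0 : ℝ), HasDerivWithinAt (fun x : ℝ => 2 / (τ * x + 1) - 1)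
      (-(2 * τ) / (τ * x + 1) ^ 2) (Set.Ioi 0) x := by
    intro x hx
    have hx' : 0 < τ * x := mul_pos hτ hx
    have h1 : HasDerivAt (fun x : ℝ => τ * x + 1) τ x := by
      simpa using ((hasDerivAt_id x).const_mul τ).add_const 1
    have h2 := (((hasDerivAt_const x (2 : ℝ)).div h1 (by positivity)).sub_const 1)
    refine (h2.congr_deriv ?_).hasDerivWithinAt
    simp
  rw [← himg, integral_image_eq_integral_abs_deriv_smul measurableSet_Ioi hder hinj,
    ← integral_const_mul]
  refine setIntegral_congr_fun measurableSet_Ioi fun x hx => ?_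
  have hx0 : 0 < x := hx
  have hx' : 0 < τ * x := mul_pos hτ hx
  obtain ⟨k, rfl⟩ := Nat.exists_eq_add_of_le hi
  have hu : 0 < τ * x + 1 := by positivity
  have e1 : 1 - (2 / (τ * x + 1) - 1) = τ * x * (2 / (τ * x + 1)) := by
    field_simp; ring
  have e2 : 1 + (2 / (τ * x + 1) - 1) = 2 / (τ * x + 1) := by ring
  have e3 : |-(2 * τ) / (τ * x + 1) ^ 2| = 2 * τ / (τ * x + 1) ^ 2 := by
    rw [neg_div, abs_neg, abs_of_pos (by positivity)]
  have e4 : 2 + k - 2 = k := by omega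
  have e5 : 2 / (τ * x + 1) / 2 = 1 / (τ * x + 1) := by field_simp
  have hw : 0 < 2 / (τ * x + 1) := by positivity
  have e6 : (2 / (τ * x + 1)) ^ α * (2 / (τ * x + 1)) ^ (1 - α) = 2 / (τ * x + 1) := by
    rw [← Real.rpow_add hw]; simp
  have e7 : τ ^ (-α) * τ ^ α = 1 := by
    rw [← Real.rpow_add hτ]; simp
  have e8 : x ^ (α - 1) * x = x ^ α := by
    rw [Real.rpow_sub_one hx0.ne']; field_simp
  simp only [smul_eq_mul]
  rw [e1, e2, e3, e4, e5, Real.mul_rpow hx'.le hw.le, Real.mul_rpow hτ.le hx0.le]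
  calc x ^ (α - 1) * (τ * x / (τ * x + 1) ^ (2 + k + 1))
      = (x ^ (α - 1) * x) * τ / (τ * x + 1) ^ (2 + k + 1) := by ring
    _ = (τ ^ (-α) * τ ^ α) * x ^ α * τ / (τ * x + 1) ^ (2 + k + 1) := by rw [e8, e7, one_mul]
    _ = (τ ^ (-α) * τ ^ α) * x ^ α / 4 * (2 / (τ * x + 1)) * (1 / (τ * x + 1)) ^ k
          * (2 * τ / (τ * x + 1) ^ 2) := by
        rw [one_div, inv_pow, pow_succ, pow_add]
        field_simp
        norm_num
    _ = (τ ^ (-α) * τ ^ α) * x ^ α / 4 *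
          ((2 / (τ * x + 1)) ^ α * (2 / (τ * x + 1)) ^ (1 - α)) * (1 / (τ * x + 1)) ^ k
          * (2 * τ / (τ * x + 1) ^ 2) := by rw [e6]
    _ = _ := by ring
end

section
/- Let α ∈ (0,1), τ > 0, and let i ≥ 1 be an integer. Let f(ζ) = (((1-ζ)+(1-ζ)²/2)/τ)^α, which is real-analytic in a neighborhood of ζ = 0, and let d^α_{2,i} = f^{(i)}(0)/i! be its i-th Taylor coefficient at 0. Then d^α_{2,i} = (1/(Γ(1-α)Γ(α))) ∫₀^∞ s^{α-1} · (τs/(1+σ(s))) · ( (3+σ(s))^{-(i+1)} − (1-σ(s))^{-(i+1)} ) ds, where σ(s) = -1 + √(1-2τs) with √ the principal complex square root, and the integral converges absolutely. -/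
open MeasureTheory

/-- Taylor coefficients of `1 / (q - 4 z + z ^ 2)`. -/
noncomputable def sbdB (q : ℝ) : ℕ → ℝ
  | 0 => 1 / q
  | 1 => 4 / q ^ 2
  | (n + 2) => (4 * sbdB q (n + 1) - sbdB q n) / q

/-- Taylor coefficients of `(3 - 4 z + z ^ 2) / (q - 4 z + z ^ 2)`. -/
noncomputable def sbdA (q : ℝ) (n : ℕ) : ℝ := (if n = 0 then 1 else 0) - (q - 3) * sbdB q n

lemma sbdB_bound (q : ℝ) (hq : 3 ≤ q) (n : ℕ) :
    |sbdB q (n + 1)| ≤ 2 * 2 ^ (n + 1) / q ^ 2 ∧ |sbdB q (n + 2)| ≤ 2 * 2 ^ (n + 2) / q ^ 2 := by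
  have hq0 : 0 < q := by linarith
  induction n with
  | zero =>
    constructor
    · simp only [sbdB]
      rw [abs_of_pos (by positivity)]
      norm_num
    · simp only [sbdB]
      rw [abs_le]
      constructor
      · rw [neg_le_iff_add_nonneg]
        have : (4 * (4 / q ^ 2) - 1 / q) / q + 2 * 2 ^ (0 + 2) / q ^ 2 = (16 + 7 * q) / q ^ 3 := by
          field_simp
          ring
        rw [this]; positivity
      · rw [← sub_nonneg]
        have : 2 * 2 ^ (0 + 2) / q ^ 2 - (4 * (4 / q ^ 2) - 1 / q) / q = (9 * q - 16) / q ^ 3 := by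
          field_simp
          ring
        rw [this]
        apply div_nonneg <;> [linarith; positivity]
  | succ n ih =>
    refine ⟨ih.2, ?_⟩
    have h : sbdB q (n + 1 + 2) = (4 * sbdB q (n + 2) - sbdB q (n + 1)) / q := rfl
    rw [h, abs_div, abs_of_pos hq0, div_le_iff₀ hq0]
    have h1 : |4 * sbdB q (n + 2) - sbdB q (n + 1)| ≤ 4 * |sbdB q (n + 2)| + |sbdB q (n + 1)| := by
      refine (abs_sub _ _).trans ?_
      rw [abs_mul]; norm_num
    have h2 : 0 ≤ 2 * 2 ^ (n + 1) / q ^ 2 := by positivity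
    have e2 : (2 : ℝ) * 2 ^ (n + 2) / q ^ 2 = 2 * (2 * 2 ^ (n + 1) / q ^ 2) := by ring
    have e3 : (2 : ℝ) * 2 ^ (n + 1 + 2) / q ^ 2 = 4 * (2 * 2 ^ (n + 1) / q ^ 2) := by ring
    have := ih.1
    have := ih.2
    rw [e3]
    rw [e2] at this
    nlinarith

lemma sbdA_bound (q : ℝ) (hq : 3 ≤ q) (n : ℕ) : |sbdA q n| ≤ 3 / q * 2 ^ n := by
  have hq0 : 0 < q := by linarith
  cases n with
  | zero =>
    have : sbdA q 0 = 3 / q := by simp only [sbdA, sbdB]; field_simp; simp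
    rw [this, abs_of_pos (by positivity)]; simp
  | succ n =>
    have h := (sbdB_bound q hq n).1
    simp only [sbdA, Nat.succ_ne_zero, if_false, zero_sub, abs_neg, abs_mul]
    rw [abs_of_nonneg (by linarith)]
    calc (q - 3) * |sbdB q (n + 1)| ≤ q * (2 * 2 ^ (n + 1) / q ^ 2) := by
          gcongr; linarith
      _ = 2 / q * 2 ^ (n + 1) := by field_simp
      _ ≤ _ := by gcongr; norm_num

lemma sbdB_bound' (q : ℝ) (hq : 3 ≤ q) (n : ℕ) : |sbdB q n| ≤ 1 * 2 ^ n := by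
  have hq0 : 0 < q := by linarith
  cases n with
  | zero =>
    simp only [sbdB]
    rw [abs_of_pos (by positivity), div_le_iff₀ hq0]; linarith
  | succ n =>
    refine ((sbdB_bound q hq n).1).trans ?_
    rw [div_le_iff₀ (by positivity)]
    have : (0 : ℝ) < 2 ^ (n + 1) := by positivity
    have h2 : 2 ≤ q ^ 2 := by nlinarith
    rw [one_mul, mul_comm]
    gcongr

lemma sbdB_hasSum (q z : ℝ) (hq : 3 ≤ q) (hz : |z| < 1 / 2) :
    Summable (fun n => sbdB q n * z ^ n) ∧
      (q - 4 * z + z ^ 2) * ∑' n, sbdB q n * z ^ n = 1 := by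
  have hq0 : 0 < q := by linarith
  have hs : Summable (fun n => sbdB q n * z ^ n) := by
    refine Summable.of_norm_bounded (g := fun n => (2 * |z|) ^ n)
      (summable_geometric_of_lt_one (by positivity) (by linarith)) fun n => ?_
    rw [norm_mul, norm_pow, mul_pow, Real.norm_eq_abs, Real.norm_eq_abs]
    gcongr
    simpa using sbdB_bound' q hq n
  refine ⟨hs, ?_⟩
  have hs1 : Summable (fun n => sbdB q (n + 1) * z ^ (n + 1)) := (summable_nat_add_iff 1).2 hs
  have e0 := hs.tsum_eq_zero_add
  have e1 := hs1.tsum_eq_zero_add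
  have e2 : ∑' n, sbdB q (n + 1 + 1) * z ^ (n + 1 + 1) =
      4 * z / q * (∑' n, sbdB q (n + 1) * z ^ (n + 1)) - z ^ 2 / q * ∑' n, sbdB q n * z ^ n := by
    rw [← tsum_mul_left, ← tsum_mul_left, ← (hs1.mul_left _).tsum_sub (hs.mul_left _)]
    refine tsum_congr fun n => ?_
    have h : sbdB q (n + 1 + 1) = (4 * sbdB q (n + 1) - sbdB q n) / q := rfl
    rw [h]; field_simp; ring
  rw [e2] at e1
  generalize (∑' n, sbdB q n * z ^ n) = S at *
  generalize (∑' n, sbdB q (n + 1) * z ^ (n + 1)) = S1 at *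
  have hb0 : sbdB q 0 = 1 / q := rfl
  have hb1 : sbdB q (0 + 1) = 4 / q ^ 2 := rfl
  rw [hb0] at e0
  rw [hb1] at e1
  have : S1 = S - 1 / q := by rw [e0]; simp
  subst this
  field_simp at e1
  have h3 : q * ((q - 4 * z + z ^ 2) * S - 1) = 0 := by linear_combination e1
  rcases mul_eq_zero.1 h3 with h | h
  · exact absurd h hq0.ne'
  · linarith

lemma sbdA_hasSum (q z : ℝ) (hq : 3 ≤ q) (hz : |z| < 1 / 2) :
    HasSum (fun n => sbdA q n * z ^ n) (1 - (q - 3) / (q - 4 * z + z ^ 2)) := by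
  obtain ⟨hs, he⟩ := sbdB_hasSum q z hq hz
  have h0 : HasSum (fun n : ℕ => if n = 0 then (1 : ℝ) else 0) 1 := hasSum_ite_eq 0 1
  have h := h0.sub (hs.hasSum.mul_left (q - 3))
  have hne : (q - 4 * z + z ^ 2) ≠ 0 := fun h => by simp [h] at he
  have : ∑' n, sbdB q n * z ^ n = 1 / (q - 4 * z + z ^ 2) := by
    field_simp; linarith
  rw [this] at h
  have hfun : (fun n => sbdA q n * z ^ n) =
      fun n => (if n = 0 then 1 else 0) - (q - 3) * (sbdB q n * z ^ n) := by
    funext n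
    simp only [sbdA]
    split_ifs with hn
    · subst hn; simp
    · ring
  rw [hfun, div_eq_mul_one_div]
  exact h

lemma sbdB_closed (q : ℝ) (u v : ℂ) (huv : u * v = q) (hs : u + v = 4) (hq : (q : ℂ) ≠ 0) (n : ℕ) :
    (sbdB q n : ℂ) * (v - u) = (u ^ (n + 1))⁻¹ - (v ^ (n + 1))⁻¹ ∧
    (sbdB q (n + 1) : ℂ) * (v - u) = (u ^ (n + 2))⁻¹ - (v ^ (n + 2))⁻¹ := by
  have hu : u ≠ 0 := by rintro rfl; simp at huv; exact hq huv.symm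
  have hv : v ≠ 0 := by rintro rfl; simp at huv; exact hq huv.symm
  induction n with
  | zero =>
    simp only [sbdB]
    push_cast
    rw [← huv, ← hs]
    constructor
    · field_simp
    · field_simp
      ring
  | succ n ih =>
    refine ⟨ih.2, ?_⟩
    have h : sbdB q (n + 1 + 1) = (4 * sbdB q (n + 1) - sbdB q n) / q := rfl
    rw [h]
    push_cast
    rw [div_mul_eq_mul_div, sub_mul, mul_assoc, ih.1, ih.2, ← huv, ← hs]
    field_simp
    ring

lemma sbdB_measurable (n : ℕ) : Measurable (fun q => sbdB q n) ∧
    Measurable (fun q => sbdB q (n + 1)) := by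
  induction n with
  | zero => simp only [sbdB]; constructor <;> fun_prop
  | succ n ih =>
    refine ⟨ih.2, ?_⟩
    have h1 := ih.1
    have h2 := ih.2
    simp only [sbdB]
    fun_prop

lemma sbdA_measurable (n : ℕ) : Measurable (fun q => sbdA q n) := by
  have := (sbdB_measurable n).1
  unfold sbdA
  fun_prop

lemma sbd_const (α : ℝ) (hα : α ∈ Set.Ioo (0 : ℝ) 1) :
    ∫ t in Set.Ioi (0 : ℝ), Real.rpowIntegrand₀₁ α t 1 = Real.Gamma (1 - α) * Real.Gamma α := by
  obtain ⟨h0, h1⟩ := hα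
  have hB := Complex.Gamma_mul_Gamma_eq_betaIntegral (s := (α : ℂ)) (t := ((1 - α : ℝ) : ℂ))
    (by simpa using h0) (by rw [Complex.ofReal_re]; linarith)
  rw [← Complex.ofReal_add, add_sub_cancel, Complex.ofReal_one, Complex.Gamma_one, one_mul,
    Complex.Gamma_ofReal, Complex.Gamma_ofReal] at hB
  have hI : Complex.betaIntegral α ((1 - α : ℝ) : ℂ) =
      ((∫ x in Set.Ioo (0 : ℝ) 1, x ^ (α - 1) * (1 - x) ^ (-α) : ℝ) : ℂ) := by
    rw [Complex.betaIntegral, intervalIntegral.integral_of_le zero_le_one,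
      integral_Ioc_eq_integral_Ioo, ← integral_complex_ofReal]
    refine setIntegral_congr_fun measurableSet_Ioo fun x hx => ?_
    push_cast
    rw [Complex.ofReal_cpow hx.1.le, Complex.ofReal_cpow (by linarith [hx.2])]
    push_cast
    congr 2
    ring
  rw [hI] at hB
  have hB' : Real.Gamma α * Real.Gamma (1 - α) =
    ∫ x in Set.Ioo (0 : ℝ) 1, x ^ (α - 1) * (1 - x) ^ (-α) := by exact_mod_cast hB
  rw [mul_comm, hB']
  have himg : (fun t : ℝ => t / (1 + t)) '' Set.Ioi 0 = Set.Ioo 0 1 := by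
    ext x
    simp only [Set.mem_image, Set.mem_Ioi, Set.mem_Ioo]
    constructor
    · rintro ⟨t, ht, rfl⟩
      refine ⟨by positivity, ?_⟩
      rw [div_lt_one (by positivity)]; linarith
    · rintro ⟨hx0, hx1⟩
      have : 0 < 1 - x := by linarith
      refine ⟨x / (1 - x), by positivity, ?_⟩
      field_simp
      ring
  rw [← himg, integral_image_eq_integral_abs_deriv_smul (f' := fun t => 1 / (1 + t) ^ 2)
    measurableSet_Ioi]
  · refine setIntegral_congr_fun measurableSet_Ioi fun t ht => ?_
    have ht : 0 < t := ht
    change Real.rpowIntegrand₀₁ α t 1 =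
      |1 / (1 + t) ^ 2| • ((t / (1 + t)) ^ (α - 1) * (1 - t / (1 + t)) ^ (-α))
    rw [Real.rpowIntegrand₀₁_eq_pow_div ⟨h0, h1⟩ ht.le zero_le_one, abs_of_pos (by positivity)]
    have e : 1 - t / (1 + t) = (1 + t)⁻¹ := by field_simp; ring
    have hp : 0 < 1 + t := by linarith
    rw [e, Real.div_rpow ht.le hp.le, Real.inv_rpow hp.le, Real.rpow_neg hp.le, inv_inv,
      Real.rpow_sub_one hp.ne']
    have := (Real.rpow_pos_of_pos hp α).ne'
    rw [smul_eq_mul]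
    field_simp
    ring
  · intro t ht
    have ht : 0 < t := ht
    have hd : HasDerivAt (fun t : ℝ => t / (1 + t)) ((1 * (1 + t) - t * 1) / (1 + t) ^ 2) t :=
      (hasDerivAt_id t).div ((hasDerivAt_id t).const_add 1) (by simp; positivity)
    have e : (1 * (1 + t) - t * 1) / (1 + t) ^ 2 = 1 / (1 + t) ^ 2 := by
      congr 1; ring
    rw [e] at hd
    exact hd.hasDerivWithinAt
  · intro a ha b hb hab
    have ha : 0 < a := ha
    have hb : 0 < b := hb
    simp only at hab
    field_simp at hab
    linarith

lemma sbd_norm_le (α τ : ℝ) (hα : α ∈ Set.Ioo (0 : ℝ) 1) (hτ : 0 < τ) (n : ℕ) (s : ℝ)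
    (hs : 0 < s) : ‖s ^ (α - 1) * sbdA (3 + 2 * τ * s) n‖ ≤
      Real.rpowIntegrand₀₁ α s (3 / (2 * τ)) * 2 ^ n := by
  have hb := sbdA_bound (3 + 2 * τ * s) (by nlinarith [mul_pos hτ hs]) n
  rw [Real.rpowIntegrand₀₁_eq_pow_div hα hs.le (by positivity), norm_mul, Real.norm_eq_abs,
    Real.norm_eq_abs, abs_of_pos (Real.rpow_pos_of_pos hs _)]
  have e : s ^ (α - 1) * (3 / (2 * τ)) / (s + 3 / (2 * τ)) * 2 ^ n =
      s ^ (α - 1) * (3 / (3 + 2 * τ * s) * 2 ^ n) := by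
    field_simp
    ring
  rw [e]
  have := Real.rpow_pos_of_pos hs (α - 1)
  gcongr

lemma sbd_integrable (α τ : ℝ) (hα : α ∈ Set.Ioo (0 : ℝ) 1) (hτ : 0 < τ) (n : ℕ) :
    IntegrableOn (fun s => s ^ (α - 1) * sbdA (3 + 2 * τ * s) n) (Set.Ioi (0 : ℝ)) := by
  refine Integrable.mono' (g := fun s => Real.rpowIntegrand₀₁ α s (3 / (2 * τ)) * 2 ^ n)
    ((Real.integrableOn_rpowIntegrand₀₁_Ioi hα (by positivity)).mul_const _) ?_ ?_
  · have := sbdA_measurable n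
    apply Measurable.aestronglyMeasurable
    fun_prop
  · exact ae_restrict_of_forall_mem measurableSet_Ioi fun s hs => sbd_norm_le α τ hα hτ n s hs

lemma sbd_hasSum (α τ : ℝ) (hα : α ∈ Set.Ioo (0 : ℝ) 1) (hτ : 0 < τ) (z : ℝ) (hz : |z| < 1 / 2) :
    HasSum (fun n => z ^ n * ((1 / (Real.Gamma (1 - α) * Real.Gamma α)) *
      ∫ s in Set.Ioi (0 : ℝ), s ^ (α - 1) * sbdA (3 + 2 * τ * s) n))
      ((((1 - z) + (1 - z) ^ 2 / 2) / τ) ^ α) := by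
  have hz' := abs_lt.1 hz
  have hP : 0 < ((1 - z) + (1 - z) ^ 2 / 2) / τ := by
    have : 0 < 1 - z := by linarith
    positivity
  rw [Real.rpow_eq_const_mul_integral hα hP.le, sbd_const α hα, ← one_div]
  have key := hasSum_integral_of_summable_integral_norm (μ := volume.restrict (Set.Ioi (0 : ℝ)))
    (F := fun n s => s ^ (α - 1) * sbdA (3 + 2 * τ * s) n * z ^ n)
    (fun n => (sbd_integrable α τ hα hτ n).mul_const _) ?_
  · have h2 := key.mul_left (1 / (Real.Gamma (1 - α) * Real.Gamma α))
    have hfun : (fun n => z ^ n * ((1 / (Real.Gamma (1 - α) * Real.Gamma α)) *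
        ∫ s in Set.Ioi (0 : ℝ), s ^ (α - 1) * sbdA (3 + 2 * τ * s) n)) = fun n =>
        1 / (Real.Gamma (1 - α) * Real.Gamma α) *
          ∫ s in Set.Ioi (0 : ℝ), s ^ (α - 1) * sbdA (3 + 2 * τ * s) n * z ^ n := by
      funext n
      rw [integral_mul_const]; ring
    rw [hfun]
    refine (congrArg (HasSum _) ?_).mpr h2
    · congr 1
      refine setIntegral_congr_fun measurableSet_Ioi fun s hs => ?_
      have hs : 0 < s := hs
      have hts := mul_pos hτ hs
      have h3 := (sbdA_hasSum (3 + 2 * τ * s) z (by nlinarith) hz).mul_left (s ^ (α - 1))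
      simp only [mul_assoc] at h3 ⊢
      rw [h3.tsum_eq, Real.rpowIntegrand₀₁_eq_pow_div hα hs.le hP.le, mul_div_assoc]
      congr 1
      have hd : 3 + 2 * (τ * s) - 4 * z + z ^ 2 ≠ 0 := by nlinarith
      have e1 : ((1 - z) + (1 - z) ^ 2 / 2) / τ =
          ((3 + 2 * (τ * s) - 4 * z + z ^ 2) - 2 * (τ * s)) / (2 * τ) := by
        field_simp; ring
      have e2 : s + ((3 + 2 * (τ * s) - 4 * z + z ^ 2) - 2 * (τ * s)) / (2 * τ) =
          (3 + 2 * (τ * s) - 4 * z + z ^ 2) / (2 * τ) := by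
        field_simp; ring
      rw [e1, e2, add_sub_cancel_left, div_div_div_cancel_right₀ (by positivity), sub_div,
        div_self hd]
  · refine Summable.of_nonneg_of_le (fun n => integral_nonneg fun s => norm_nonneg _) (fun n => ?_)
      ((summable_geometric_of_lt_one (r := 2 * |z|) (by positivity) (by linarith)).mul_left
        (∫ s in Set.Ioi (0 : ℝ), Real.rpowIntegrand₀₁ α s (3 / (2 * τ))))
    rw [← integral_mul_const]
    refine setIntegral_mono_on ((sbd_integrable α τ hα hτ n).mul_const _).norm
      ((Real.integrableOn_rpowIntegrand₀₁_Ioi hα (by positivity)).mul_const _)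
      measurableSet_Ioi fun s hs => ?_
    rw [norm_mul, mul_pow, ← mul_assoc, norm_pow, Real.norm_eq_abs z]
    gcongr
    exact sbd_norm_le α τ hα hτ n s hs

lemma sbd_coeff (α τ : ℝ) (hα : α ∈ Set.Ioo (0 : ℝ) 1) (hτ : 0 < τ) (i : ℕ)
    (f : ℝ → ℝ) (hf : ∀ ζ : ℝ, f ζ = (((1 - ζ) + (1 - ζ) ^ 2 / 2) / τ) ^ α) :
    iteratedDeriv i f 0 / (Nat.factorial i) = (1 / (Real.Gamma (1 - α) * Real.Gamma α)) *
      ∫ s in Set.Ioi (0 : ℝ), s ^ (α - 1) * sbdA (3 + 2 * τ * s) i := by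
  have h1 : HasFPowerSeriesAt f (FormalMultilinearSeries.ofScalars ℝ
      (fun n => (1 / (Real.Gamma (1 - α) * Real.Gamma α)) *
        ∫ s in Set.Ioi (0 : ℝ), s ^ (α - 1) * sbdA (3 + 2 * τ * s) n)) 0 := by
    rw [hasFPowerSeriesAt_iff]
    filter_upwards [Metric.ball_mem_nhds (0 : ℝ) (by norm_num : (0 : ℝ) < 1 / 2)] with z hz
    rw [zero_add, hf]
    simp only [FormalMultilinearSeries.coeff_ofScalars, smul_eq_mul]
    exact sbd_hasSum α τ hα hτ z (by simpa using hz)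
  have h2 := (AnalyticAt.hasFPowerSeriesAt h1.analyticAt).eq_formalMultilinearSeries h1
  have h3 := congrArg (fun p => FormalMultilinearSeries.coeff p i) h2
  simpa only [FormalMultilinearSeries.coeff_ofScalars] using h3

lemma sbd_integrand (α τ : ℝ) (hτ : 0 < τ) (i : ℕ) (hi : 1 ≤ i)
    (σ : ℝ → ℂ) (hσs : ∀ s : ℝ, σ s = -1 + (1 - 2 * (τ : ℂ) * (s : ℂ)) ^ ((1 : ℂ) / 2))
    (s : ℝ) (hs : 0 < s) (hne : s ≠ 1 / (2 * τ)) :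
    (s : ℂ) ^ ((α : ℂ) - 1) * (((τ : ℂ) * (s : ℂ)) / (1 + σ s)) *
        ((3 + σ s) ^ (-(i + 1 : ℤ)) - (1 - σ s) ^ (-(i + 1 : ℤ))) =
      ((s ^ (α - 1) * sbdA (3 + 2 * τ * s) i : ℝ) : ℂ) := by
  have hsq : (1 + σ s) ^ 2 = 1 - 2 * (τ : ℂ) * (s : ℂ) := by
    rw [hσs, add_neg_cancel_left, one_div]
    exact Complex.cpow_nat_inv_pow _ two_ne_zero
  have hne0 : (1 + σ s) ≠ 0 := by
    intro h
    rw [h] at hsq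
    have : (0 : ℝ) = 1 - 2 * τ * s := by
      have h0 : (0 : ℂ) = 1 - 2 * (τ : ℂ) * (s : ℂ) := by rw [← hsq]; simp
      exact_mod_cast h0
    apply hne
    field_simp
    linarith
  have hq : 0 < 3 + 2 * τ * s := by positivity
  have hc := (sbdB_closed (3 + 2 * τ * s) (1 - σ s) (3 + σ s)
    (by push_cast; linear_combination -hsq) (by ring) (by exact_mod_cast hq.ne') i).1
  have hz : ∀ x : ℂ, x ^ (-(i + 1 : ℤ)) = (x ^ (i + 1))⁻¹ := fun x => by
    rw [zpow_neg]; norm_cast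
  rw [hz, hz, ← neg_sub ((1 - σ s) ^ (i + 1))⁻¹, ← hc]
  have hi0 : i ≠ 0 := by omega
  simp only [sbdA, hi0, if_false]
  push_cast
  rw [Complex.ofReal_cpow hs.le]
  push_cast
  field_simp
  ring

/-- Let `α ∈ (0,1)`, `τ > 0`, `i ≥ 1`. With `f(ζ) = (((1-ζ)+(1-ζ)²/2)/τ)^α` and
`d^α_{2,i} = f^{(i)}(0)/i!` its `i`-th Taylor coefficient at `0`, one has
`d^α_{2,i} = (1/(Γ(1-α)Γ(α))) ∫₀^∞ s^{α-1} (τs/(1+σ(s))) ((3+σ(s))^{-(i+1)} − (1-σ(s))^{-(i+1)}) ds`,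
where `σ(s) = -1 + √(1-2τs)` (principal complex square root), and the integral converges
absolutely. -/
theorem statement6 (α τ : ℝ) (hα : α ∈ Set.Ioo (0 : ℝ) 1) (hτ : 0 < τ)
    (i : ℕ) (hi : 1 ≤ i)
    (f : ℝ → ℝ) (hf : ∀ ζ : ℝ, f ζ = (((1 - ζ) + (1 - ζ) ^ 2 / 2) / τ) ^ α)
    (d : ℝ) (hd : d = iteratedDeriv i f 0 / (Nat.factorial i))
    (σ : ℝ → ℂ) (hσs : ∀ s : ℝ, σ s = -1 + (1 - 2 * (τ : ℂ) * (s : ℂ)) ^ ((1 : ℂ) / 2)) :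
    MeasureTheory.IntegrableOn
      (fun s : ℝ => (s : ℂ) ^ ((α : ℂ) - 1) * (((τ : ℂ) * (s : ℂ)) / (1 + σ s)) *
        ((3 + σ s) ^ (-(i + 1 : ℤ)) - (1 - σ s) ^ (-(i + 1 : ℤ))))
      (Set.Ioi (0 : ℝ)) ∧
    (d : ℂ) = ((1 / (Real.Gamma (1 - α) * Real.Gamma α) : ℝ) : ℂ) *
      ∫ s in Set.Ioi (0 : ℝ), (s : ℂ) ^ ((α : ℂ) - 1) * (((τ : ℂ) * (s : ℂ)) / (1 + σ s)) *
        ((3 + σ s) ^ (-(i + 1 : ℤ)) - (1 - σ s) ^ (-(i + 1 : ℤ))) := by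
  have hae : (fun s : ℝ => (s : ℂ) ^ ((α : ℂ) - 1) * (((τ : ℂ) * (s : ℂ)) / (1 + σ s)) *
        ((3 + σ s) ^ (-(i + 1 : ℤ)) - (1 - σ s) ^ (-(i + 1 : ℤ))))
      =ᵐ[volume.restrict (Set.Ioi (0 : ℝ))]
      fun s => ((s ^ (α - 1) * sbdA (3 + 2 * τ * s) i : ℝ) : ℂ) := by
    have h1 : ∀ᵐ s ∂(volume.restrict (Set.Ioi (0 : ℝ))), s ≠ 1 / (2 * τ) :=
      ae_restrict_of_ae (Measure.ae_ne volume _)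
    filter_upwards [h1, ae_restrict_mem measurableSet_Ioi] with s hs1 hs2
    exact sbd_integrand α τ hτ i hi σ hσs s hs2 hs1
  constructor
  · exact (integrable_congr hae).2 (sbd_integrable α τ hα hτ i).ofReal
  · rw [integral_congr_ae hae, hd, sbd_coeff α τ hα hτ i f hf, integral_complex_ofReal]
    push_cast
    rfl
end

section
/- Let α ∈ (0,1) and let i ≥ 3 be an integer. Then ∫₂^∞ (σ(σ-2)/2)^α (1+σ)^{-(i+1)} dσ = 2^{2+2α} ∫_{-1}^{1} (1-s)^α (1+s)^{2-2α} ((1+s)/(s+5))^{i-3} (s+5)^{-4} ds, and both integrals converge absolutely. -/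
open MeasureTheory

/-- For `α ∈ (0,1)` and integer `i ≥ 3`,
`∫₂^∞ (σ(σ-2)/2)^α (1+σ)^{-(i+1)} dσ
  = 2^{2+2α} ∫_{-1}^{1} (1-s)^α (1+s)^{2-2α} ((1+s)/(s+5))^{i-3} (s+5)^{-4} ds`,
and both integrals converge absolutely. -/
theorem statement7 (α : ℝ) (hα : α ∈ Set.Ioo (0 : ℝ) 1) (i : ℕ) (hi : 3 ≤ i) :
    MeasureTheory.IntegrableOn
      (fun σ : ℝ => (σ * (σ - 2) / 2) ^ α * (1 + σ) ^ (-(i + 1 : ℤ))) (Set.Ioi (2 : ℝ)) ∧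
    MeasureTheory.IntegrableOn
      (fun s : ℝ => (1 - s) ^ α * (1 + s) ^ (2 - 2 * α) * ((1 + s) / (s + 5)) ^ (i - 3) *
        (s + 5) ^ (-(4 : ℤ))) (Set.Ioo (-1 : ℝ) 1) ∧
    ∫ σ in Set.Ioi (2 : ℝ), (σ * (σ - 2) / 2) ^ α * (1 + σ) ^ (-(i + 1 : ℤ)) =
      (2 : ℝ) ^ (2 + 2 * α) *
        ∫ s in Set.Ioo (-1 : ℝ) 1,
          (1 - s) ^ α * (1 + s) ^ (2 - 2 * α) * ((1 + s) / (s + 5)) ^ (i - 3) *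
            (s + 5) ^ (-(4 : ℤ)) := by
  obtain ⟨h0, h1⟩ := hα
  have himg : Set.image (fun s : ℝ => 4 / (1 + s)) (Set.Ioo (-1 : ℝ) 1) = Set.Ioi 2 := by
    ext σ
    simp only [Set.mem_image, Set.mem_Ioo, Set.mem_Ioi]
    constructor
    · rintro ⟨s, ⟨hs1, hs2⟩, rfl⟩
      rw [lt_div_iff₀ (by linarith)]
      linarith
    · intro h
      have hp : 0 < 4 / σ := by positivity
      have hl : 4 / σ < 2 := by
        rw [div_lt_iff₀ (by linarith)]
        linarith
      refine ⟨4 / σ - 1, ⟨by linarith, by linarith⟩, ?_⟩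
      have : σ ≠ 0 := by linarith
      field_simp
      ring_nf
  have hinj : Set.InjOn (fun s : ℝ => 4 / (1 + s)) (Set.Ioo (-1 : ℝ) 1) := by
    intro a ha b hb hab
    have h1 : 1 + a ≠ 0 := by linarith [ha.1]
    have h2 : 1 + b ≠ 0 := by linarith [hb.1]
    simp only at hab
    rw [div_eq_div_iff h1 h2] at hab
    linarith
  have hder : ∀ s ∈ Set.Ioo (-1 : ℝ) 1,
      HasDerivWithinAt (fun s : ℝ => 4 / (1 + s)) (-4 / (1 + s) ^ 2) (Set.Ioo (-1 : ℝ) 1) s := by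
    intro s hs
    have h1 : 1 + s ≠ 0 := by linarith [hs.1]
    have := ((hasDerivAt_const s (4 : ℝ)).div ((hasDerivAt_id s).const_add 1) h1).hasDerivWithinAt
      (s := Set.Ioo (-1 : ℝ) 1)
    refine this.congr_deriv ?_
    simp
  have hpt : ∀ s ∈ Set.Ioo (-1 : ℝ) 1,
      |-4 / (1 + s) ^ 2| • ((4 / (1 + s) * (4 / (1 + s) - 2) / 2) ^ α *
        (1 + 4 / (1 + s)) ^ (-(i + 1 : ℤ))) =
      (2 : ℝ) ^ (2 + 2 * α) * ((1 - s) ^ α * (1 + s) ^ (2 - 2 * α) *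
        ((1 + s) / (s + 5)) ^ (i - 3) * (s + 5) ^ (-(4 : ℤ))) := by
    intro s hs
    obtain ⟨k, rfl⟩ := Nat.exists_eq_add_of_le hi
    have hx : 0 < 1 + s := by linarith [hs.1]
    have hy : 0 < 1 - s := by linarith [hs.2]
    have hz : 0 < s + 5 := by linarith
    have e1 : |-4 / (1 + s) ^ 2| = 4 / (1 + s) ^ 2 := by
      rw [neg_div, abs_neg, abs_of_pos (by positivity)]
    have e2 : 4 / (1 + s) * (4 / (1 + s) - 2) / 2 = 4 * (1 - s) / (1 + s) ^ 2 := by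
      field_simp
      ring
    have e3 : 1 + 4 / (1 + s) = (s + 5) / (1 + s) := by
      field_simp
      ring
    have e4 : ((s + 5) / (1 + s)) ^ (-(((3 + k : ℕ) : ℤ) + 1)) =
        ((1 + s) / (s + 5)) ^ (k + 4) := by
      rw [zpow_neg, ← inv_zpow, inv_div, ← zpow_natCast]
      congr 1
      push_cast
      ring
    have e5 : ((1 + s) ^ 2) ^ α = (1 + s) ^ (2 * α) := by
      rw [Real.rpow_mul hx.le, Real.rpow_two]
    have e6 : (2 : ℝ) ^ (2 + 2 * α) = 4 * 4 ^ α := by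
      rw [Real.rpow_add (by norm_num), Real.rpow_mul (by norm_num), Real.rpow_two]
      norm_num
    have e7 : (1 + s) ^ (2 - 2 * α) = (1 + s) ^ 2 / (1 + s) ^ (2 * α) := by
      rw [Real.rpow_sub hx, Real.rpow_two]
    have e8 : (s + 5) ^ (-(4 : ℤ)) = ((s + 5) ^ 4)⁻¹ := by
      rw [zpow_neg]
      norm_cast
    rw [e1, e2, e3, e4, e6, e7, e8, Real.div_rpow (by positivity) (by positivity),
      Real.mul_rpow (by norm_num) hy.le, e5, Nat.add_sub_cancel_left, smul_eq_mul, pow_add,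
      div_pow (1 + s) (s + 5) 4]
    have : (1 + s) ^ (2 * α) ≠ 0 := ne_of_gt (Real.rpow_pos_of_pos hx _)
    generalize ((1 + s) / (s + 5)) ^ k = c
    field_simp
  have hR : IntegrableOn
      (fun s : ℝ => (1 - s) ^ α * (1 + s) ^ (2 - 2 * α) * ((1 + s) / (s + 5)) ^ (i - 3) *
        (s + 5) ^ (-(4 : ℤ))) (Set.Ioo (-1 : ℝ) 1) := by
    refine IntegrableOn.mono_set (t := Set.Icc (-1 : ℝ) 1) ?_ Set.Ioo_subset_Icc_self
    refine ContinuousOn.integrableOn_compact isCompact_Icc ?_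
    have hne : ∀ s ∈ Set.Icc (-1 : ℝ) 1, s + 5 ≠ 0 := fun s hs => by linarith [hs.1]
    refine ContinuousOn.mul (ContinuousOn.mul (ContinuousOn.mul ?_ ?_) ?_) ?_
    · exact ContinuousOn.rpow_const (by fun_prop) (fun _ _ => Or.inr h0.le)
    · exact ContinuousOn.rpow_const (by fun_prop) (fun _ _ => Or.inr (by linarith))
    · exact (ContinuousOn.div (by fun_prop) (by fun_prop) hne).pow _
    · exact ContinuousOn.zpow₀ (by fun_prop) _ (fun s hs => Or.inl (hne s hs))
  refine ⟨?_, hR, ?_⟩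
  · rw [← himg, integrableOn_image_iff_integrableOn_abs_deriv_smul measurableSet_Ioo hder hinj]
    exact (integrableOn_congr_fun hpt measurableSet_Ioo).mpr (hR.const_mul _)
  · rw [← himg, integral_image_eq_integral_abs_deriv_smul measurableSet_Ioo hder hinj,
      setIntegral_congr_fun measurableSet_Ioo hpt, integral_const_mul]
end
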